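/- (Maximum principle for antisymmetric supersolutions in unbounded sets.) Let H ⊂ ℝ^d be an open half-space, Ω ⊂ H open, and c_∞, R > 0. Then there is δ > 0 such that the following holds: if c ∈ L^∞(Ω) with c⁻ ≤ c_∞ admits a set K ⊂ Ω with Ω∖K ⊂ B_R(0) and c ≥ 0 on K, and if u ∈ C_b(ℝ^d) is antisymmetric with respect to H and a viscosity supersolution of Ψ(−Δ)u + c(x)u = 0 in Ω with u ≥ 0 on (H∖Ω) ∪ ((Ω ∩ {x ∈ H : dist(x,∂H) ≥ δ})∖K) and liminf_{x∈H, |x|→∞} u(x) ≥ 0, then u ≥ 0 in H. -/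

import Mathlib

open MeasureTheory Set Filter Metric Asymptotics
open scoped RealInnerProductSpace ENNReal Topology NNReal

noncomputable section

abbrev Rd (d : ℕ) := EuclideanSpace ℝ (Fin d)

/-- The data of a Bernstein function `Ψ` vanishing at `0`, its Lévy measure `𝔪`,
and the weak scaling conditions. -/
structure PsiSetting (d : ℕ) where
  Ψ : ℝ → ℝ
  m : Measure ℝ
  m_onIoi : m (Set.Iic 0) = 0
  smooth : ContDiffOn ℝ (⊤ : ℕ∞) Ψ (Set.Ioi 0)
  nonneg : ∀ x > (0:ℝ), 0 ≤ Ψ x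
  deriv_alt : ∀ n : ℕ, ∀ x > (0:ℝ),
    (-1 : ℝ) ^ (n + 1) * iteratedDerivWithin (n + 1) Ψ (Set.Ioi 0) x ≤ 0
  zero_lim : Filter.Tendsto Ψ (nhdsWithin 0 (Set.Ioi 0)) (nhds 0)
  levy_rep : ∀ lam > (0:ℝ), Ψ lam = ∫ t, (1 - Real.exp (-lam * t)) ∂m
  a₁ : ℝ
  a₂ : ℝ
  b₁ : ℝ
  b₂ : ℝ
  ha₁ : 0 < a₁
  ha₁₂ : a₁ ≤ a₂
  ha₂ : a₂ < 1
  hb₁ : 1 ≤ b₁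
  hb₂ : 1 < b₂
  scaling_lower : ∀ r R : ℝ, 1 ≤ r → r ≤ R → (1 / b₁) * (R / r) ^ a₁ ≤ Ψ R / Ψ r
  scaling_upper : ∀ r R : ℝ, 1 ≤ r → r ≤ R → Ψ R / Ψ r ≤ b₁ * (R / r) ^ a₂

/-- The jump kernel `j(r) = ∫_0^∞ (4πt)^{-d/2} e^{-r²/(4t)} 𝔪(dt)`. -/
def PsiSetting.j {d : ℕ} (S : PsiSetting d) (r : ℝ) : ℝ :=
  ∫ t, (4 * Real.pi * t) ^ (-(d : ℝ) / 2) * Real.exp (-(r ^ 2) / (4 * t)) ∂S.m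

/-- The condition `j(r) ≤ b₂ j(r+1)` for `r ≥ 1`. -/
def PsiSetting.kernelCond {d : ℕ} (S : PsiSetting d) : Prop :=
  ∀ r : ℝ, 1 ≤ r → S.j r ≤ S.b₂ * S.j (r + 1)

/-- The nonlocal operator `Ψ(−Δ)` applied to a test function. -/
def psiOp {d : ℕ} (S : PsiSetting d) (φ : Rd d → ℝ) (x : Rd d) : ℝ :=
  ∫ z : Rd d,
    (φ x - φ (x + z) + (if ‖z‖ ≤ 1 then ⟪z, gradient φ x⟫ else 0)) * S.j ‖z‖

/-- Admissible test functions at `x`: bounded continuous and C² near `x`. -/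
def TestAt {d : ℕ} (x : Rd d) (φ : Rd d → ℝ) : Prop :=
  (∃ M, ∀ y, |φ y| ≤ M) ∧ Continuous φ ∧ ∃ U ∈ nhds x, ContDiffOn ℝ 2 φ U

/-- Viscosity supersolution of `Ψ(−Δ)u + c·u = g` in `Ω`. -/
def IsSuperSol {d : ℕ} (S : PsiSetting d) (Ω : Set (Rd d)) (c g u : Rd d → ℝ) : Prop :=
  LowerSemicontinuous u ∧
    ∀ x ∈ Ω, ∀ φ : Rd d → ℝ, TestAt x φ → φ x = u x → (∀ y, y ≠ x → φ y < u y) →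
      g x ≤ psiOp S φ x + c x * u x

/-- Viscosity subsolution of `Ψ(−Δ)u + c·u = g` in `Ω`. -/
def IsSubSol {d : ℕ} (S : PsiSetting d) (Ω : Set (Rd d)) (c g u : Rd d → ℝ) : Prop :=
  UpperSemicontinuous u ∧
    ∀ x ∈ Ω, ∀ φ : Rd d → ℝ, TestAt x φ → φ x = u x → (∀ y, y ≠ x → u y < φ y) →
      psiOp S φ x + c x * u x ≤ g x

/-- Viscosity solution of `Ψ(−Δ)u + c·u = g` in `Ω`. -/
def IsSol {d : ℕ} (S : PsiSetting d) (Ω : Set (Rd d)) (c g u : Rd d → ℝ) : Prop :=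
  IsSubSol S Ω c g u ∧ IsSuperSol S Ω c g u

/-- `V` is the renewal function of the ascending ladder-height process associated with `Ψ`. -/
structure IsRenewal (Ψ V : ℝ → ℝ) : Prop where
  nonneg : ∀ x, 0 ≤ V x
  zero : ∀ x ≤ (0:ℝ), V x = 0
  cont : ContinuousOn V (Set.Ioi 0)
  mono : StrictMonoOn V (Set.Ioi 0)
  laplace : ∀ s : ℝ, 0 < s →
    (∫ x in Set.Ioi (0 : ℝ), V x * Real.exp (-s * x)) =
      1 / (s * Real.exp ((1 / Real.pi) *
        ∫ y in Set.Ioi (0 : ℝ), Real.log (Ψ (s * y)) / (1 + y ^ 2)))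

/-- `tr_V(u)(x) = t`: the `V`-trace of `u` at the boundary point `x` of `D`. -/
def HasVTrace {d : ℕ} (V : ℝ → ℝ) (D : Set (Rd d)) (u : Rd d → ℝ)
    (x : Rd d) (t : ℝ) : Prop :=
  Filter.Tendsto (fun z => u z / V (Metric.infDist z Dᶜ)) (nhdsWithin x D) (nhds t)

/-- An open set has C² boundary. -/
def HasC2Boundary {d : ℕ} (D : Set (Rd d)) : Prop :=
  ∀ x ∈ frontier D, ∃ (U : Set (Rd d)) (f : Rd d → ℝ),
    IsOpen U ∧ x ∈ U ∧ ContDiffOn ℝ 2 f U ∧ (∀ y ∈ U, fderiv ℝ f y ≠ 0) ∧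
      D ∩ U = {y ∈ U | f y < 0}

/-- A closed set has C² boundary. -/
def HasC2BoundaryClosed {d : ℕ} (G : Set (Rd d)) : Prop :=
  ∀ x ∈ frontier G, ∃ (U : Set (Rd d)) (f : Rd d → ℝ),
    IsOpen U ∧ x ∈ U ∧ ContDiffOn ℝ 2 f U ∧ (∀ y ∈ U, fderiv ℝ f y ≠ 0) ∧
      G ∩ U = {y ∈ U | f y ≤ 0}

/-- Reflection `R_{λ,e}` across the hyperplane `{x·e = λ}`. -/
def reflAt {d : ℕ} (e : Rd d) (lam : ℝ) (x : Rd d) : Rd d :=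
  x - (2 * ⟪x, e⟫ - 2 * lam) • e

/-- The open half-space `H_{λ,e} = {x·e > λ}`. -/
def halfSpace {d : ℕ} (e : Rd d) (lam : ℝ) : Set (Rd d) := {x | lam < ⟪x, e⟫}

/-- A function is antisymmetric with respect to the half-space `H_{λ,e}`. -/
def AntiSym {d : ℕ} (e : Rd d) (lam : ℝ) (u : Rd d → ℝ) : Prop :=
  ∀ x, u x = - u (reflAt e lam x)

/-- The Gauss-Weierstrass kernel in dimension `d` at time `t` and radius `r`. -/
def heatProfile (d : ℕ) (t r : ℝ) : ℝ :=
  (4 * Real.pi * t) ^ (-(d : ℝ) / 2) * Real.exp (-(r ^ 2) / (4 * t))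

lemma heatProfile_pos (d : ℕ) {t : ℝ} (ht : 0 < t) (r : ℝ) : 0 < heatProfile d t r := by
  unfold heatProfile; positivity

lemma measurable_heatProfile (d : ℕ) :
    Measurable (fun p : ℝ × ℝ => heatProfile d p.1 p.2) := by
  unfold heatProfile; fun_prop

lemma heatProfile_antitone (d : ℕ) {t : ℝ} (ht : 0 < t) {r s : ℝ} (hr : 0 ≤ r) (hrs : r ≤ s) :
    heatProfile d t s ≤ heatProfile d t r := by
  unfold heatProfile; gcongr

lemma div_one_add_le_one_sub_exp_neg {t : ℝ} (ht : 0 < t) : t / (1 + t) ≤ 1 - Real.exp (-t) := by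
  have h : Real.exp (-t) ≤ 1 / (1 + t) := by
    rw [Real.exp_neg, ← one_div]
    exact one_div_le_one_div_of_le (by linarith) (by linarith [Real.add_one_le_exp t])
  have : t / (1 + t) = 1 - 1 / (1 + t) := by field_simp; ring
  linarith

/-- For fixed radius, the heat profile is dominated by the Lévy weight `1 - e^{-t}`. -/
lemma exists_heatProfile_le (d : ℕ) {r : ℝ} (hr : 0 < r) :
    ∃ C : ℝ, ∀ t > 0, heatProfile d t r ≤ C * (1 - Real.exp (-t)) := by
  refine ⟨(Real.pi * r ^ 2) ^ (-(d : ℝ) / 2) *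
    ((4 + r ^ 2) / r ^ 2 * ((d + 1).factorial * Real.exp 1)), fun t ht => ?_⟩
  set s := r ^ 2 / (4 * t) with hs
  have hs0 : 0 < s := by positivity
  have ht' : t / (1 + t) = r ^ 2 / (4 * s + r ^ 2) := by rw [hs]; field_simp
  have hbase : (4 * Real.pi * t) ^ (-(d : ℝ) / 2) =
      (Real.pi * r ^ 2) ^ (-(d : ℝ) / 2) * s ^ ((d : ℝ) / 2) := by
    have : 4 * Real.pi * t = (Real.pi * r ^ 2) * s⁻¹ := by rw [hs]; field_simp
    rw [this, Real.mul_rpow (by positivity) (by positivity), Real.inv_rpow hs0.le,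
      neg_div, Real.rpow_neg hs0.le, inv_inv]
  have hpow : s ^ ((d : ℝ) / 2) ≤ (1 + s) ^ d := by
    calc s ^ ((d : ℝ) / 2) ≤ (1 + s) ^ ((d : ℝ) / 2) :=
          Real.rpow_le_rpow hs0.le (by linarith) (by positivity)
      _ ≤ (1 + s) ^ (d : ℝ) := Real.rpow_le_rpow_of_exponent_le (by linarith)
          (by have : (0 : ℝ) ≤ d := by positivity
              linarith)
      _ = (1 + s) ^ d := Real.rpow_natCast _ _
  have hfac := Real.pow_div_factorial_le_exp (x := 1 + s) (by positivity) (d + 1)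
  rw [div_le_iff₀ (by positivity), Real.exp_add] at hfac
  have hmain : s ^ ((d : ℝ) / 2) * Real.exp (-s) ≤
      (4 + r ^ 2) / r ^ 2 * ((d + 1).factorial * Real.exp 1) * (r ^ 2 / (4 * s + r ^ 2)) := by
    have h1 : s ^ ((d : ℝ) / 2) * (4 * s + r ^ 2) ≤
        (4 + r ^ 2) * ((d + 1).factorial * Real.exp 1) * Real.exp s := by
      calc s ^ ((d : ℝ) / 2) * (4 * s + r ^ 2)
          ≤ (1 + s) ^ d * ((4 + r ^ 2) * (1 + s)) := by
            gcongr
            nlinarith [sq_nonneg r]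
        _ = (4 + r ^ 2) * (1 + s) ^ (d + 1) := by ring
        _ ≤ (4 + r ^ 2) * (Real.exp 1 * Real.exp s * (d + 1).factorial) := by gcongr
        _ = _ := by ring
    rw [Real.exp_neg, ← div_eq_mul_inv, div_le_iff₀ (Real.exp_pos s)]
    have h2 : (4 + r ^ 2) / r ^ 2 * ((d + 1).factorial * Real.exp 1) * (r ^ 2 / (4 * s + r ^ 2)) *
        Real.exp s =
        (4 + r ^ 2) * ((d + 1).factorial * Real.exp 1) * Real.exp s / (4 * s + r ^ 2) := by
      field_simp
    rw [h2, le_div_iff₀ (by positivity)]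
    exact h1
  have hexp : -(r ^ 2) / (4 * t) = -s := by rw [hs, neg_div]
  calc heatProfile d t r
      = (Real.pi * r ^ 2) ^ (-(d : ℝ) / 2) * (s ^ ((d : ℝ) / 2) * Real.exp (-s)) := by
        unfold heatProfile; rw [hbase, hexp]; ring
    _ ≤ (Real.pi * r ^ 2) ^ (-(d : ℝ) / 2) *
        ((4 + r ^ 2) / r ^ 2 * ((d + 1).factorial * Real.exp 1) * (r ^ 2 / (4 * s + r ^ 2))) := by
        gcongr
    _ = (Real.pi * r ^ 2) ^ (-(d : ℝ) / 2) *
        ((4 + r ^ 2) / r ^ 2 * ((d + 1).factorial * Real.exp 1)) * (t / (1 + t)) := by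
        rw [ht']; ring
    _ ≤ _ := by
        gcongr
        exact div_one_add_le_one_sub_exp_neg ht

lemma lintegral_exp_neg_mul_norm_sq (d : ℕ) {b : ℝ} (hb : 0 < b) :
    ∫⁻ z : Rd d, ENNReal.ofReal (Real.exp (-b * ‖z‖ ^ 2)) =
      ENNReal.ofReal ((Real.pi / b) ^ ((d : ℝ) / 2)) := by
  have hval := GaussianFourier.integral_rexp_neg_mul_sq_norm (V := Rd d) hb
  have hint : Integrable (fun z : Rd d => Real.exp (-b * ‖z‖ ^ 2)) := by
    by_contra h
    rw [integral_undef h] at hval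
    have : 0 < (Real.pi / b) ^ (Module.finrank ℝ (Rd d) / 2 : ℝ) := by positivity
    linarith
  rw [← ofReal_integral_eq_lintegral_ofReal hint (ae_of_all _ fun _ => (Real.exp_pos _).le), hval]
  simp

lemma lintegral_heatProfile (d : ℕ) {t : ℝ} (ht : 0 < t) :
    ∫⁻ z : Rd d, ENNReal.ofReal (heatProfile d t ‖z‖) = 1 := by
  have h (z : Rd d) : ENNReal.ofReal (heatProfile d t ‖z‖) =
      ENNReal.ofReal ((4 * Real.pi * t) ^ (-(d : ℝ) / 2)) *
        ENNReal.ofReal (Real.exp (-(1 / (4 * t)) * ‖z‖ ^ 2)) := by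
    rw [← ENNReal.ofReal_mul (by positivity)]
    unfold heatProfile
    congr 3
    ring
  simp_rw [h]
  rw [lintegral_const_mul' _ _ ENNReal.ofReal_ne_top,
    lintegral_exp_neg_mul_norm_sq d (by positivity), ← ENNReal.ofReal_mul (by positivity)]
  have : Real.pi / (1 / (4 * t)) = 4 * Real.pi * t := by field_simp
  rw [this, ← Real.rpow_add (by positivity)]
  simp [neg_div]

lemma norm_sq_mul_heatProfile_le (d : ℕ) {t : ℝ} (ht : 0 < t) (r : ℝ) :
    r ^ 2 * heatProfile d t r ≤
      8 * t * (4 * Real.pi * t) ^ (-(d : ℝ) / 2) * Real.exp (-(1 / (8 * t)) * r ^ 2) := by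
  have h1 : r ^ 2 / (8 * t) ≤ Real.exp (r ^ 2 / (8 * t)) := by
    linarith [Real.add_one_le_exp (r ^ 2 / (8 * t))]
  have h2 : r ^ 2 * Real.exp (-(r ^ 2) / (4 * t)) ≤
      8 * t * Real.exp (-(1 / (8 * t)) * r ^ 2) := by
    have e1 : Real.exp (-(r ^ 2) / (4 * t)) =
        Real.exp (-(1 / (8 * t)) * r ^ 2) * (Real.exp (r ^ 2 / (8 * t)))⁻¹ := by
      rw [← Real.exp_neg, ← Real.exp_add]; congr 1; field_simp; ring
    have e2 : r ^ 2 * (Real.exp (r ^ 2 / (8 * t)))⁻¹ ≤ 8 * t := by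
      rw [← div_eq_mul_inv, div_le_iff₀ (Real.exp_pos _)]
      rw [div_le_iff₀ (by positivity)] at h1
      linarith
    rw [e1]
    calc _ = (r ^ 2 * (Real.exp (r ^ 2 / (8 * t)))⁻¹) * Real.exp (-(1 / (8 * t)) * r ^ 2) := by ring
      _ ≤ _ := by gcongr
  unfold heatProfile
  calc _ = (4 * Real.pi * t) ^ (-(d : ℝ) / 2) * (r ^ 2 * Real.exp (-(r ^ 2) / (4 * t))) := by ring
    _ ≤ (4 * Real.pi * t) ^ (-(d : ℝ) / 2) *
        (8 * t * Real.exp (-(1 / (8 * t)) * r ^ 2)) := by gcongr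
    _ = _ := by ring

/-- The truncated second moment of the heat kernel is dominated by the Lévy weight. -/
lemma exists_lintegral_min_heatProfile_le (d : ℕ) :
    ∃ C : ℝ, ∀ t > 0,
      ∫⁻ z : Rd d, ENNReal.ofReal (min 1 (‖z‖ ^ 2) * heatProfile d t ‖z‖) ≤
        ENNReal.ofReal (C * (1 - Real.exp (-t))) := by
  set A : ℝ := 8 * 2 ^ ((d : ℝ) / 2) with hA
  have hA0 : 0 < A := by positivity
  refine ⟨A + 1, fun t ht => ?_⟩
  have h1 : ∫⁻ z : Rd d, ENNReal.ofReal (min 1 (‖z‖ ^ 2) * heatProfile d t ‖z‖) ≤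
      ENNReal.ofReal 1 := by
    rw [ENNReal.ofReal_one, ← lintegral_heatProfile d ht]
    refine lintegral_mono fun z => ENNReal.ofReal_le_ofReal ?_
    exact mul_le_of_le_one_left (heatProfile_pos d ht _).le (min_le_left _ _)
  have h2 : ∫⁻ z : Rd d, ENNReal.ofReal (min 1 (‖z‖ ^ 2) * heatProfile d t ‖z‖) ≤
      ENNReal.ofReal (A * t) := by
    calc _ ≤ ∫⁻ z : Rd d, ENNReal.ofReal (8 * t * (4 * Real.pi * t) ^ (-(d : ℝ) / 2)) *
            ENNReal.ofReal (Real.exp (-(1 / (8 * t)) * ‖z‖ ^ 2)) := by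
          refine lintegral_mono fun z => ?_
          rw [← ENNReal.ofReal_mul (by positivity)]
          refine ENNReal.ofReal_le_ofReal (le_trans ?_ (norm_sq_mul_heatProfile_le d ht ‖z‖))
          exact mul_le_mul_of_nonneg_right (min_le_right _ _) (heatProfile_pos d ht _).le
      _ = ENNReal.ofReal (A * t) := by
          rw [lintegral_const_mul' _ _ ENNReal.ofReal_ne_top,
            lintegral_exp_neg_mul_norm_sq d (by positivity), ← ENNReal.ofReal_mul (by positivity)]
          congr 1
          have h : Real.pi / (1 / (8 * t)) = 2 * (4 * Real.pi * t) := by field_simp; norm_num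
          have hp : 0 < 4 * Real.pi * t := by positivity
          rw [h, Real.mul_rpow (by norm_num) hp.le, neg_div, Real.rpow_neg hp.le, hA]
          have := Real.rpow_pos_of_pos hp ((d : ℝ) / 2)
          generalize (4 * Real.pi * t) ^ ((d : ℝ) / 2) = q at *
          field_simp
  have h3 : min 1 (A * t) ≤ (A + 1) * (1 - Real.exp (-t)) := by
    refine le_trans ?_ (mul_le_mul_of_nonneg_left (div_one_add_le_one_sub_exp_neg ht) (by linarith))
    rw [← mul_div_assoc, le_div_iff₀ (by linarith)]
    rcases le_total 1 (A * t) with h | h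
    · rw [min_eq_left h]; linarith
    · rw [min_eq_right h]; nlinarith
  refine le_trans ?_ (ENNReal.ofReal_le_ofReal h3)
  rcases le_total 1 (A * t) with h | h
  · rwa [min_eq_left h]
  · rwa [min_eq_right h]

namespace PsiSetting

variable {d : ℕ} (S : PsiSetting d)

lemma j_eq (r : ℝ) : S.j r = ∫ t, heatProfile d t r ∂S.m := rfl

lemma ae_pos : ∀ᵐ t ∂S.m, 0 < t := by
  rw [ae_iff]
  have : {t : ℝ | ¬ 0 < t} = Set.Iic 0 := by ext; simp
  rw [this, S.m_onIoi]

lemma Psi_one_pos : 0 < S.Ψ 1 := by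
  have h := S.scaling_lower 1 1 le_rfl le_rfl
  refine lt_of_le_of_ne (S.nonneg 1 one_pos) fun h0 => ?_
  rw [← h0] at h
  have := S.hb₁
  have : 0 < 1 / S.b₁ * (1 / 1) ^ S.a₁ := by simp; linarith
  simp only [div_zero] at h
  linarith

lemma integrable_one_sub_exp_neg : Integrable (fun t => 1 - Real.exp (-t)) S.m := by
  have h := S.levy_rep 1 one_pos
  by_contra hn
  rw [integral_undef (by simpa using hn)] at h
  exact S.Psi_one_pos.ne' h

lemma sigmaFinite : SigmaFinite S.m := by
  obtain ⟨T, hT, h0, hs⟩ :=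
    S.integrable_one_sub_exp_neg.aefinStronglyMeasurable.exists_set_sigmaFinite
  have hz : S.m Tᶜ = 0 := by
    rw [← Measure.restrict_eq_zero, ← ae_eq_bot, ← Filter.eventually_false_iff_eq_bot]
    filter_upwards [h0, ae_restrict_of_ae S.ae_pos] with t h1 h2
    have := Real.exp_lt_exp.2 (neg_lt_zero.2 h2)
    rw [Real.exp_zero] at this
    simp only [Pi.zero_apply] at h1
    linarith
  rw [← Measure.restrict_add_restrict_compl (μ := S.m) hT, Measure.restrict_eq_zero.2 hz, add_zero]
  exact hs

/-- The lower scaling condition forces the Lévy measure to be infinite. -/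
lemma m_univ : S.m Set.univ = ∞ := by
  by_contra hfin
  have : IsFiniteMeasure S.m := ⟨lt_top_iff_ne_top.2 hfin⟩
  have hbd (R : ℝ) (hR : 1 ≤ R) : S.Ψ R ≤ S.m.real Set.univ := by
    rw [S.levy_rep R (by linarith)]
    calc ∫ t, (1 - Real.exp (-R * t)) ∂S.m ≤ ∫ _, (1 : ℝ) ∂S.m := by
          refine integral_mono_of_nonneg ?_ (integrable_const _) ?_
          · filter_upwards [S.ae_pos] with t ht
            have : Real.exp (-R * t) ≤ 1 := Real.exp_le_one_iff.2 (by nlinarith)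
            simp only [Pi.zero_apply]
            linarith
          · exact ae_of_all _ fun t => by
              have := Real.exp_pos (-R * t)
              simp only
              linarith
      _ = S.m.real Set.univ := by simp
  have hlow : Tendsto (fun R : ℝ => (1 / S.b₁) * R ^ S.a₁) atTop atTop :=
    (tendsto_rpow_atTop S.ha₁).const_mul_atTop (by have := S.hb₁; positivity)
  obtain ⟨R, hR1, hR2⟩ := ((eventually_ge_atTop 1).and
    (hlow.eventually_gt_atTop (S.m.real Set.univ / S.Ψ 1))).exists
  have h1 := S.scaling_lower 1 R le_rfl hR1
  rw [div_one] at h1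
  have h2 := div_le_div_of_nonneg_right (hbd R hR1) S.Psi_one_pos.le
  linarith

lemma integrable_heatProfile {r : ℝ} (hr : 0 < r) :
    Integrable (fun t => heatProfile d t r) S.m := by
  obtain ⟨C, hC⟩ := exists_heatProfile_le d hr
  refine (S.integrable_one_sub_exp_neg.const_mul C).mono'
    ((measurable_heatProfile d).comp (measurable_id.prodMk measurable_const)).aestronglyMeasurable ?_
  filter_upwards [S.ae_pos] with t ht
  rw [Real.norm_of_nonneg (heatProfile_pos d ht r).le]
  exact hC t ht

lemma j_nonneg (r : ℝ) : 0 ≤ S.j r := by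
  rw [j_eq]
  exact integral_nonneg_of_ae (S.ae_pos.mono fun t ht => (heatProfile_pos d ht r).le)

lemma j_pos {r : ℝ} (hr : 0 < r) : 0 < S.j r := by
  refine lt_of_le_of_ne (S.j_nonneg r) fun h => ?_
  rw [j_eq, eq_comm, integral_eq_zero_iff_of_nonneg_ae
    (S.ae_pos.mono fun t ht => (heatProfile_pos d ht r).le) (S.integrable_heatProfile hr)] at h
  have : S.m = 0 := by
    rw [← ae_eq_bot, ← Filter.eventually_false_iff_eq_bot]
    filter_upwards [h, S.ae_pos] with t h1 h2
    exact (heatProfile_pos d h2 r).ne' h1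
  simpa [this] using S.m_univ

lemma j_antitone {r s : ℝ} (hr : 0 < r) (hrs : r ≤ s) : S.j s ≤ S.j r :=
  integral_mono_ae (S.integrable_heatProfile (hr.trans_le hrs)) (S.integrable_heatProfile hr)
    (S.ae_pos.mono fun _ ht => heatProfile_antitone d ht hr.le hrs)

lemma measurable_j : Measurable S.j := by
  have := S.sigmaFinite
  have h : StronglyMeasurable (fun r => ∫ t, heatProfile d t r ∂S.m) :=
    StronglyMeasurable.integral_prod_right (f := fun r t => heatProfile d t r)
      ((measurable_heatProfile d).comp measurable_swap).stronglyMeasurable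
  exact h.measurable

lemma ofReal_j {r : ℝ} (hr : 0 < r) :
    ENNReal.ofReal (S.j r) = ∫⁻ t, ENNReal.ofReal (heatProfile d t r) ∂S.m :=
  ofReal_integral_eq_lintegral_ofReal (S.integrable_heatProfile hr)
    (S.ae_pos.mono fun _ ht => (heatProfile_pos d ht r).le)

/-- Tonelli's theorem for the subordination formula defining the jump kernel. -/
lemma lintegral_mul_j (hd : 0 < d) {w : Rd d → ℝ} (hw : Measurable w) (hw0 : ∀ z, 0 ≤ w z) :
    ∫⁻ z : Rd d, ENNReal.ofReal (w z * S.j ‖z‖) =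
      ∫⁻ t, (∫⁻ z : Rd d, ENNReal.ofReal (w z * heatProfile d t ‖z‖)) ∂S.m := by
  have := S.sigmaFinite
  have : Nonempty (Fin d) := ⟨⟨0, hd⟩⟩
  rw [← lintegral_lintegral_swap]
  · refine lintegral_congr_ae ?_
    filter_upwards [Measure.ae_ne volume (0 : Rd d)] with z hz
    rw [ENNReal.ofReal_mul (hw0 z), S.ofReal_j (norm_pos_iff.2 hz),
      ← lintegral_const_mul' _ _ ENNReal.ofReal_ne_top]
    simp_rw [ENNReal.ofReal_mul (hw0 z)]
  · refine Measurable.aemeasurable ?_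
    have h1 : Measurable fun p : Rd d × ℝ => heatProfile d p.2 ‖p.1‖ :=
      (measurable_heatProfile d).comp (measurable_snd.prodMk measurable_fst.norm)
    exact ((hw.comp measurable_fst).mul h1).ennreal_ofReal

lemma lintegral_j (hd : 0 < d) : ∫⁻ z : Rd d, ENNReal.ofReal (S.j ‖z‖) = ∞ := by
  have h := S.lintegral_mul_j hd (w := fun _ => 1) measurable_const fun _ => zero_le_one
  simp only [one_mul] at h
  rw [h, lintegral_congr_ae (S.ae_pos.mono fun t ht => lintegral_heatProfile d ht)]
  simp [S.m_univ]

/-- The jump kernel is a Lévy density. -/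
lemma integrable_min_mul_j (hd : 0 < d) :
    Integrable fun z : Rd d => min 1 (‖z‖ ^ 2) * S.j ‖z‖ := by
  have hm : Measurable fun z : Rd d => min 1 (‖z‖ ^ 2) := by fun_prop
  refine ⟨(hm.mul (S.measurable_j.comp measurable_norm)).aestronglyMeasurable, ?_⟩
  rw [hasFiniteIntegral_iff_ofReal
    (ae_of_all _ fun z => mul_nonneg (by positivity) (S.j_nonneg _)),
    S.lintegral_mul_j hd hm fun z => by positivity]
  obtain ⟨C, hC⟩ := exists_lintegral_min_heatProfile_le d
  refine (lintegral_mono_ae (S.ae_pos.mono hC)).trans_lt ?_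
  exact (S.integrable_one_sub_exp_neg.const_mul C).lintegral_lt_top

end PsiSetting

/-- Reflections across hyperplanes preserve volume. -/
lemma measurePreserving_reflAt {d : ℕ} {e : Rd d} (he : ‖e‖ = 1) (lam : ℝ) :
    MeasurePreserving (reflAt e lam) := by
  have h1 : MeasurePreserving (Submodule.reflection (Submodule.span ℝ {e})ᗮ : Rd d → Rd d) :=
    LinearIsometryEquiv.measurePreserving _
  have h2 := (measurePreserving_add_right (volume : Measure (Rd d)) ((2 * lam) • e)).comp h1
  convert! h2 using 1
  ext1 x
  simp only [reflAt, Function.comp_apply, Submodule.reflection_orthogonal_apply,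
    Submodule.reflection_singleton_apply, he, real_inner_comm x e]
  rw [sub_smul, mul_smul, two_smul ℝ (⟪x, e⟫ • e)]
  simp [two_smul]
  abel

lemma inner_reflAt {d : ℕ} {e : Rd d} (he : ‖e‖ = 1) (lam : ℝ) (x : Rd d) :
    ⟪reflAt e lam x, e⟫ = 2 * lam - ⟪x, e⟫ := by
  simp only [reflAt, inner_sub_left, real_inner_smul_left, real_inner_self_eq_norm_sq, he]
  ring

lemma reflAt_reflAt {d : ℕ} {e : Rd d} (he : ‖e‖ = 1) (lam : ℝ) (x : Rd d) :
    reflAt e lam (reflAt e lam x) = x := by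
  rw [reflAt, inner_reflAt he]
  simp only [reflAt]
  module

lemma reflAt_eq_self {d : ℕ} {e : Rd d} {lam : ℝ} {x : Rd d} (hx : ⟪x, e⟫ = lam) :
    reflAt e lam x = x := by
  simp [reflAt, hx]

lemma reflAt_add {d : ℕ} (e : Rd d) (lam : ℝ) (x z : Rd d) :
    reflAt e lam (x + z) = x + reflAt e (lam - ⟪x, e⟫) z := by
  simp only [reflAt, inner_add_left]
  module

lemma norm_le_norm_reflAt {d : ℕ} {e : Rd d} (he : ‖e‖ = 1) {lam : ℝ} (hlam : lam ≤ 0) {z : Rd d}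
    (hz : lam ≤ ⟪z, e⟫) : ‖z‖ ≤ ‖reflAt e lam z‖ := by
  have h : ‖reflAt e lam z‖ ^ 2 = ‖z‖ ^ 2 - 4 * lam * (⟪z, e⟫ - lam) := by
    rw [reflAt, norm_sub_sq_real, norm_smul, mul_pow, he, real_inner_smul_right, Real.norm_eq_abs,
      sq_abs]
    ring
  refine le_of_sq_le_sq ?_ (norm_nonneg _)
  nlinarith

lemma le_norm_of_inner_lt {d : ℕ} {e : Rd d} (he : ‖e‖ = 1) {a : ℝ} {z : Rd d} (hz : ⟪z, e⟫ < -a) :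
    a ≤ ‖z‖ := by
  have := abs_real_inner_le_norm z e
  rw [he, mul_one] at this
  linarith [neg_abs_le ⟪z, e⟫]

lemma measurableSet_inner_lt {d : ℕ} (e : Rd d) (a : ℝ) : MeasurableSet {z : Rd d | ⟪z, e⟫ < a} :=
  (isOpen_lt (by fun_prop) continuous_const).measurableSet

namespace PsiSetting

variable {d : ℕ} (S : PsiSetting d)

lemma integrableOn_j_inner_lt (hd : 0 < d) {e : Rd d} (he : ‖e‖ = 1) {a : ℝ} (ha : 0 < a) :
    IntegrableOn (fun z : Rd d => S.j ‖z‖) {z | ⟪z, e⟫ < -a} := by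
  refine ((S.integrable_min_mul_j hd).const_mul (min 1 (a ^ 2))⁻¹).integrableOn.mono'
    (S.measurable_j.comp measurable_norm).aestronglyMeasurable ?_
  filter_upwards [ae_restrict_mem (measurableSet_inner_lt e (-a))] with z hz
  rw [Real.norm_of_nonneg (S.j_nonneg _), ← mul_assoc]
  have h0 : 0 < min 1 (a ^ 2) := by positivity
  refine le_mul_of_one_le_left (S.j_nonneg _) ?_
  rw [← div_eq_inv_mul, one_le_div h0]
  have := le_norm_of_inner_lt he hz
  gcongr

lemma setIntegral_j_inner_lt_pos (hd : 0 < d) {e : Rd d} (he : ‖e‖ = 1) {a : ℝ} (ha : 0 < a) :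
    0 < ∫ z in {z : Rd d | ⟪z, e⟫ < -a}, S.j ‖z‖ := by
  rw [setIntegral_pos_iff_support_of_nonneg_ae (ae_of_all _ fun z => S.j_nonneg _)
    (S.integrableOn_j_inner_lt hd he ha)]
  have hsub : {z : Rd d | ⟪z, e⟫ < -a} ⊆ Function.support (fun z : Rd d => S.j ‖z‖) := fun z hz =>
    (S.j_pos (ha.trans_le (le_norm_of_inner_lt he hz))).ne'
  rw [Set.inter_eq_right.2 hsub]
  refine (isOpen_lt (by fun_prop) continuous_const).measure_pos _ ⟨(-(2 * a)) • e, ?_⟩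
  simp only [Set.mem_ofPred_eq, real_inner_smul_left, real_inner_self_eq_norm_sq, he]
  linarith

lemma setIntegral_j_inner_lt_anti (hd : 0 < d) {e : Rd d} (he : ‖e‖ = 1) {a b : ℝ} (ha : 0 < a)
    (hab : a ≤ b) :
    ∫ z in {z : Rd d | ⟪z, e⟫ < -b}, S.j ‖z‖ ≤ ∫ z in {z : Rd d | ⟪z, e⟫ < -a}, S.j ‖z‖ := by
  refine setIntegral_mono_set (S.integrableOn_j_inner_lt hd he ha)
    (ae_of_all _ fun z => S.j_nonneg _) (LE.le.eventuallyLE fun z hz => ?_)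
  simp only [Set.mem_ofPred_eq] at hz ⊢
  linarith

/-- Each half-space through the origin has infinite Lévy mass. -/
lemma setLIntegral_j_inner_neg (hd : 0 < d) {e : Rd d} (he : ‖e‖ = 1) :
    ∫⁻ z in {z : Rd d | ⟪z, e⟫ < 0}, ENNReal.ofReal (S.j ‖z‖) = ∞ := by
  have hneg : ∫⁻ z in {z : Rd d | ⟪z, e⟫ < 0}ᶜ, ENNReal.ofReal (S.j ‖z‖) =
      ∫⁻ z in {z : Rd d | ⟪z, e⟫ < 0}, ENNReal.ofReal (S.j ‖z‖) := by
    have hnull : volume ((Submodule.span ℝ {e})ᗮ : Set (Rd d)) = 0 := by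
      refine Measure.addHaar_submodule _ _ fun h => ?_
      have : e ∈ (Submodule.span ℝ {e})ᗮ := h ▸ Submodule.mem_top
      rw [Submodule.mem_orthogonal_singleton_iff_inner_left, real_inner_self_eq_norm_sq, he] at this
      norm_num at this
    have hae : ({z : Rd d | ⟪z, e⟫ < 0}ᶜ : Set (Rd d)) =ᵐ[volume]
        (fun z => -z) ⁻¹' {z : Rd d | ⟪z, e⟫ < 0} := by
      filter_upwards [measure_eq_zero_iff_ae_notMem.1 hnull] with z hz
      rw [SetLike.mem_coe, Submodule.mem_orthogonal_singleton_iff_inner_left] at hz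
      refine propext ?_
      change ¬ (⟪z, e⟫ < 0) ↔ ⟪-z, e⟫ < 0
      rw [inner_neg_left, not_lt, neg_lt_zero]
      exact ⟨fun h => lt_of_le_of_ne h (Ne.symm hz), le_of_lt⟩
    rw [setLIntegral_congr hae]
    have hm : Measurable fun z : Rd d => ENNReal.ofReal (S.j ‖z‖) :=
      (S.measurable_j.comp measurable_norm).ennreal_ofReal
    simpa using (Measure.measurePreserving_neg (volume : Measure (Rd d))).setLIntegral_comp_preimage
      (measurableSet_inner_lt e 0) hm
  have h := lintegral_add_compl (μ := volume) (fun z : Rd d => ENNReal.ofReal (S.j ‖z‖))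
    (measurableSet_inner_lt e 0)
  rw [hneg, S.lintegral_j hd, ENNReal.add_eq_top, or_self] at h
  exact h

lemma exists_lt_setIntegral_j_inner_lt (hd : 0 < d) {e : Rd d} (he : ‖e‖ = 1) (M : ℝ) :
    ∃ δ > (0 : ℝ), M < ∫ z in {z : Rd d | ⟪z, e⟫ < -δ}, S.j ‖z‖ := by
  set ν := (volume : Measure (Rd d)).withDensity fun z => ENNReal.ofReal (S.j ‖z‖) with hν
  have hU : (⋃ n : ℕ, {z : Rd d | ⟪z, e⟫ < -(1 / ((n : ℝ) + 1))}) = {z : Rd d | ⟪z, e⟫ < 0} := by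
    ext z
    simp only [Set.mem_iUnion, Set.mem_ofPred_eq]
    constructor
    · rintro ⟨n, hn⟩
      have : (0 : ℝ) < 1 / ((n : ℝ) + 1) := by positivity
      linarith
    · intro h
      obtain ⟨n, hn⟩ := exists_nat_one_div_lt (neg_pos.2 h)
      exact ⟨n, by linarith⟩
  have hmono : Monotone fun n : ℕ => {z : Rd d | ⟪z, e⟫ < -(1 / ((n : ℝ) + 1))} := by
    intro n k hnk z hz
    have : 1 / ((k : ℝ) + 1) ≤ 1 / ((n : ℝ) + 1) := by gcongr
    simp only [Set.mem_ofPred_eq] at hz ⊢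
    linarith
  have ht := tendsto_measure_iUnion_atTop (μ := ν) hmono
  rw [hU, hν, withDensity_apply _ (measurableSet_inner_lt e 0),
    S.setLIntegral_j_inner_neg hd he] at ht
  obtain ⟨n, hn⟩ := (ht.eventually_const_lt (ENNReal.ofReal_lt_top (r := M))).exists
  have hδ : (0 : ℝ) < 1 / ((n : ℝ) + 1) := by positivity
  refine ⟨_, hδ, ?_⟩
  simp only [Function.comp_apply] at hn
  rw [withDensity_apply _ (measurableSet_inner_lt e _),
    ← ofReal_integral_eq_lintegral_ofReal (S.integrableOn_j_inner_lt hd he hδ)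
      (ae_of_all _ fun z => S.j_nonneg _)] at hn
  exact (ENNReal.ofReal_lt_ofReal_iff (S.setIntegral_j_inner_lt_pos hd he hδ)).1 hn

/-- Symmetrization across a hyperplane at distance `a` from the origin. -/
lemma integral_mul_j_le_of_reflAt (hd : 0 < d) {e : Rd d} (he : ‖e‖ = 1) {a : ℝ} (ha : 0 < a)
    {F : Rd d → ℝ} (hF : Integrable fun z => F z * S.j ‖z‖) {v : ℝ}
    (hlt : ∀ z, -a < ⟪z, e⟫ →
      F z * S.j ‖z‖ + F (reflAt e (-a) z) * S.j ‖reflAt e (-a) z‖ ≤ v * S.j ‖reflAt e (-a) z‖)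
    (heq : ∀ z, ⟪z, e⟫ = -a → F z ≤ 0) :
    ∫ z, F z * S.j ‖z‖ ≤ v * ∫ z in {z : Rd d | ⟪z, e⟫ < -a}, S.j ‖z‖ := by
  have hmp := measurePreserving_reflAt he (-a)
  have hemb : MeasurableEmbedding (reflAt e (-a)) :=
    (MeasurableEquiv.ofInvolutive _ (reflAt_reflAt he (-a)) hmp.measurable).measurableEmbedding
  set D : Set (Rd d) := {z | ⟪z, e⟫ < -a} with hD
  set P : Rd d → ℝ := fun z => F z * S.j ‖z‖ with hP
  set Q : Rd d → ℝ := D.indicator fun z => v * S.j ‖z‖ with hQ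
  have hQi : Integrable Q :=
    (integrable_indicator_iff (measurableSet_inner_lt e (-a))).2
      ((S.integrableOn_j_inner_lt hd he ha).const_mul v)
  have hQv : ∫ z, Q z = v * ∫ z in D, S.j ‖z‖ := by
    rw [hQ, integral_indicator (measurableSet_inner_lt e (-a)), integral_const_mul]
  have hpt (z : Rd d) : P z + P (reflAt e (-a) z) ≤ Q z + Q (reflAt e (-a) z) := by
    have hin := inner_reflAt he (-a) z
    rcases lt_trichotomy (-a) ⟪z, e⟫ with h | h | h
    · have h1 : z ∉ D := fun hz => by simp only [hD, Set.mem_ofPred_eq] at hz; linarith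
      have h2 : reflAt e (-a) z ∈ D := by simp only [hD, Set.mem_ofPred_eq]; linarith
      rw [hQ, Set.indicator_of_notMem h1, Set.indicator_of_mem h2, zero_add]
      exact hlt z h
    · have h1 : z ∉ D := fun hz => by simp only [hD, Set.mem_ofPred_eq] at hz; linarith
      rw [reflAt_eq_self h.symm, hQ, Set.indicator_of_notMem h1]
      have := mul_nonpos_of_nonpos_of_nonneg (heq z h.symm) (S.j_nonneg ‖z‖)
      simp only [hP]
      linarith
    · have h1 : z ∈ D := h
      have h2 : reflAt e (-a) z ∉ D := fun hz => by
        simp only [hD, Set.mem_ofPred_eq] at hz; linarith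
      have := hlt (reflAt e (-a) z) (by linarith)
      rw [reflAt_reflAt he] at this
      rw [hQ, Set.indicator_of_notMem h2, Set.indicator_of_mem h1, add_zero, add_comm]
      exact this
  have hP' := (hmp.integrable_comp_emb hemb).2 hF
  have hQ' := (hmp.integrable_comp_emb hemb).2 hQi
  have hint := integral_mono (hF.add hP') (hQi.add hQ') hpt
  rw [integral_add' hF hP', integral_add' hQi hQ'] at hint
  have e1 : ∫ z, ((fun z => F z * S.j ‖z‖) ∘ reflAt e (-a)) z = ∫ z, P z :=
    hmp.integral_comp hemb P
  have e2 : ∫ z, (Q ∘ reflAt e (-a)) z = ∫ z, Q z := hmp.integral_comp hemb Q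
  rw [e1, e2, hQv] at hint
  linarith

end PsiSetting

/-- A continuous function can be flattened near a local minimum point. -/
lemma exists_continuous_flat_near {d : ℕ} {u : Rd d → ℝ} (hu : Continuous u) {x₀ : Rd d} {r : ℝ}
    (hr : 0 < r) (hmin : ∀ y, ‖y - x₀‖ < r → u x₀ ≤ u y) :
    ∃ w : Rd d → ℝ, Continuous w ∧ (∀ y, ‖y - x₀‖ ≤ r / 2 → w y = u x₀) ∧
      (∀ y, r ≤ ‖y - x₀‖ → w y = u y) ∧ ∀ y, ‖y - x₀‖ < r → u x₀ ≤ w y ∧ w y ≤ u y := by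
  set η : Rd d → ℝ := fun y => max 0 (min 1 (2 - 2 * ‖y - x₀‖ / r)) with hη
  have hη0 (y : Rd d) : 0 ≤ η y := le_max_left _ _
  have hη1 (y : Rd d) : η y ≤ 1 := max_le zero_le_one (min_le_left _ _)
  refine ⟨fun y => u y + η y * (u x₀ - u y), by fun_prop, fun y hy => ?_, fun y hy => ?_,
    fun y hy => ?_⟩
  · have h1 : 2 * ‖y - x₀‖ / r ≤ 1 := by rw [div_le_one hr]; linarith
    have h2 : η y = 1 := by simp only [hη]; rw [min_eq_left (by linarith), max_eq_right zero_le_one]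
    simp [h2]
  · have h1 : 2 ≤ 2 * ‖y - x₀‖ / r := by rw [le_div_iff₀ hr]; linarith
    have h2 : η y = 0 := by
      simp only [hη]; exact max_eq_left ((min_le_right _ _).trans (by linarith))
    simp [h2]
  · have := hmin y hy
    constructor <;> nlinarith [hη0 y, hη1 y]

lemma one_sub_exp_neg_norm_sq_le {d : ℕ} (z : Rd d) :
    1 - Real.exp (-‖z‖ ^ 2) ≤ min 1 (‖z‖ ^ 2) :=
  le_min (by linarith [Real.exp_pos (-‖z‖ ^ 2)]) (by linarith [Real.add_one_le_exp (-‖z‖ ^ 2)])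

lemma one_sub_exp_neg_norm_sq_nonneg {d : ℕ} (z : Rd d) : 0 ≤ 1 - Real.exp (-‖z‖ ^ 2) := by
  have : Real.exp (-‖z‖ ^ 2) ≤ 1 := Real.exp_le_one_iff.2 (by nlinarith [sq_nonneg ‖z‖])
  linarith

lemma PsiSetting.integrable_mul_j {d : ℕ} (S : PsiSetting d) (hd : 0 < d) {F : Rd d → ℝ}
    (hF : Measurable F) {C : ℝ} (hC : ∀ z, |F z| ≤ C * min 1 (‖z‖ ^ 2)) :
    Integrable fun z : Rd d => F z * S.j ‖z‖ := by
  refine ((S.integrable_min_mul_j hd).const_mul C).mono'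
    (hF.mul (S.measurable_j.comp measurable_norm)).aestronglyMeasurable (ae_of_all _ fun z => ?_)
  rw [Real.norm_eq_abs, abs_mul, abs_of_nonneg (S.j_nonneg _), ← mul_assoc]
  exact mul_le_mul_of_nonneg_right (hC z) (S.j_nonneg _)

lemma psiOp_of_isLocalMax {d : ℕ} (S : PsiSetting d) {φ : Rd d → ℝ} {x : Rd d}
    (h : IsLocalMax φ x) : psiOp S φ x = ∫ z, (φ x - φ (x + z)) * S.j ‖z‖ := by
  have : gradient φ x = 0 := by simp [gradient, h.fderiv_eq_zero]
  simp [psiOp, this]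

/-- At a point where a supersolution attains its negative minimum over the half-space, the
zero order coefficient is bounded above by the opposite of the Lévy mass beyond the boundary. -/
lemma IsSuperSol.add_setIntegral_j_nonpos {d : ℕ} (hd : 0 < d) (S : PsiSetting d)
    {e : Rd d} (he : ‖e‖ = 1) {lam : ℝ} {Ω : Set (Rd d)} {c u : Rd d → ℝ}
    (hu : Continuous u) {M : ℝ} (hM : ∀ x, |u x| ≤ M) (hanti : AntiSym e lam u)
    (hsuper : IsSuperSol S Ω c (fun _ => 0) u) {x₀ : Rd d} (hx₀ : x₀ ∈ Ω)
    (hx₀H : x₀ ∈ halfSpace e lam) (hneg : u x₀ < 0)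
    (hmin : ∀ y ∈ halfSpace e lam, u x₀ ≤ u y) :
    c x₀ + ∫ z in {z : Rd d | ⟪z, e⟫ < -(⟪x₀, e⟫ - lam)}, S.j ‖z‖ ≤ 0 := by
  set a := ⟪x₀, e⟫ - lam with ha_def
  have ha : 0 < a := sub_pos.2 hx₀H
  have hna : lam - ⟪x₀, e⟫ = -a := by rw [ha_def]; ring
  set I := ∫ z in {z : Rd d | ⟪z, e⟫ < -a}, S.j ‖z‖ with hI
  have hopen : IsOpen (halfSpace e lam ∩ {y | u y < 0}) :=
    (isOpen_lt continuous_const (by fun_prop)).inter (isOpen_lt hu continuous_const)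
  obtain ⟨r, hr, hball⟩ := Metric.isOpen_iff.1 hopen x₀ ⟨hx₀H, hneg⟩
  have hball' (y : Rd d) (hy : ‖y - x₀‖ < r) : y ∈ halfSpace e lam ∧ u y < 0 :=
    hball (mem_ball_iff_norm.2 hy)
  have hout (y : Rd d) (hy : ⟪y, e⟫ ≤ lam) : r ≤ ‖y - x₀‖ :=
    not_lt.1 fun h => not_lt.2 hy (hball' y h).1
  obtain ⟨w, hwc, hwin, hwout, hwmid⟩ :=
    exists_continuous_flat_near hu hr fun y hy => hmin y (hball' y hy).1
  have hwM (y : Rd d) : |w y| ≤ M := by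
    rcases lt_or_ge ‖y - x₀‖ r with h | h
    · have := hwmid y h
      have h1 := abs_le.1 (hM x₀)
      have h2 := abs_le.1 (hM y)
      exact abs_le.2 ⟨by linarith, by linarith⟩
    · rw [hwout y h]; exact hM y
  have hwu (y : Rd d) : w y ≤ u y := by
    rcases lt_or_ge ‖y - x₀‖ r with h | h
    · exact (hwmid y h).2
    · rw [hwout y h]
  have hw₀ : w x₀ = u x₀ := hwin x₀ (by simp; positivity)
  set F : Rd d → ℝ := fun z => u x₀ - w (x₀ + z) with hF
  have hFi : Integrable fun z => F z * S.j ‖z‖ := by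
    refine S.integrable_mul_j hd (by fun_prop) (C := 2 * M / min 1 ((r / 2) ^ 2)) fun z => ?_
    have h0 : 0 < min 1 ((r / 2) ^ 2) := by positivity
    have hM0 : 0 ≤ M := (abs_nonneg _).trans (hM x₀)
    rcases le_total ‖z‖ (r / 2) with h | h
    · have : F z = 0 := by simp only [hF]; rw [hwin _ (by simpa using h), sub_self]
      rw [this, abs_zero]
      positivity
    · have h1 : |F z| ≤ 2 * M := (abs_sub _ _).trans (by linarith [hM x₀, hwM (x₀ + z)])
      have h2 : min 1 ((r / 2) ^ 2) ≤ min 1 (‖z‖ ^ 2) := by gcongr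
      calc |F z| ≤ 2 * M := h1
        _ = 2 * M / min 1 ((r / 2) ^ 2) * min 1 ((r / 2) ^ 2) := by field_simp
        _ ≤ _ := by gcongr
  have hFle : ∫ z, F z * S.j ‖z‖ ≤ u x₀ * I := by
    refine S.integral_mul_j_le_of_reflAt hd he ha hFi (fun z hz => ?_) fun z hz => ?_
    · have hyH : x₀ + z ∈ halfSpace e lam := by
        simp only [halfSpace, Set.mem_ofPred_eq, inner_add_left]; linarith
      have hrefl : reflAt e lam (x₀ + z) = x₀ + reflAt e (-a) z := by rw [reflAt_add, hna]
      have hFσ : F (reflAt e (-a) z) = u x₀ + u (x₀ + z) := by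
        simp only [hF]
        rw [← hrefl, hwout, hanti (x₀ + z)]
        · ring
        · refine hout _ ?_
          rw [inner_reflAt he]
          have : lam < ⟪x₀ + z, e⟫ := hyH
          linarith
      have hj := S.j_nonneg ‖z‖
      have hjσ := S.j_nonneg ‖reflAt e (-a) z‖
      have huz := hmin _ hyH
      rw [hFσ]
      rcases lt_or_ge ‖z‖ r with h | h
      · have h' : ‖x₀ + z - x₀‖ < r := by simpa using h
        have h1 : F z ≤ 0 := sub_nonpos.2 (hwmid _ h').1
        have h2 := (hball' _ h').2
        nlinarith [mul_nonneg (neg_nonneg.2 h1) hj, mul_nonneg (neg_nonneg.2 h2.le) hjσ]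
      · have h1 : F z = u x₀ - u (x₀ + z) := by
          simp only [hF]; rw [hwout _ (by simpa using h)]
        have h2 := S.j_antitone (hr.trans_le h) (norm_le_norm_reflAt he (by linarith) hz.le)
        rw [h1]
        nlinarith [mul_nonneg (sub_nonneg.2 huz) (sub_nonneg.2 h2),
          mul_nonneg (neg_nonneg.2 hneg.le) hjσ]
    · have hy : ⟪x₀ + z, e⟫ = lam := by rw [inner_add_left]; linarith
      have h0 : u (x₀ + z) = 0 := by
        have := hanti (x₀ + z)
        rw [reflAt_eq_self hy] at this
        linarith
      simp only [hF]
      rw [hwout _ (hout _ hy.le), h0]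
      linarith
  set G : Rd d → ℝ := fun z => 1 - Real.exp (-‖z‖ ^ 2) with hG
  have hGi : Integrable fun z => G z * S.j ‖z‖ := by
    refine S.integrable_mul_j hd (by fun_prop) (C := 1) fun z => ?_
    rw [one_mul, abs_of_nonneg (one_sub_exp_neg_norm_sq_nonneg z)]
    exact one_sub_exp_neg_norm_sq_le z
  have hG1 (z : Rd d) : |G z| ≤ 1 := by
    rw [abs_of_nonneg (one_sub_exp_neg_norm_sq_nonneg z)]
    exact (one_sub_exp_neg_norm_sq_le z).trans (min_le_left _ _)
  have hvisc (ε : ℝ) (hε : 0 < ε) :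
      0 ≤ u x₀ * (c x₀ + I) + ε * ∫ z, G z * S.j ‖z‖ := by
    set φ : Rd d → ℝ := fun y => w y - ε * G (y - x₀) with hφ
    have hG0 : G 0 = 0 := by simp [hG]
    have hφ₀ : φ x₀ = u x₀ := by simp [hφ, hG0, hw₀]
    have hcd : ContDiff ℝ 2 fun y : Rd d => u x₀ - ε * G (y - x₀) := by
      simp only [hG]
      exact contDiff_const.sub (contDiff_const.mul (contDiff_const.sub
        (((contDiff_id.sub contDiff_const).norm_sq ℝ).neg.exp)))
    have hφin (y : Rd d) (hy : y ∈ Metric.ball x₀ (r / 2)) :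
        φ y = u x₀ - ε * G (y - x₀) := by
      simp only [hφ]
      rw [hwin y (mem_ball_iff_norm.1 hy).le]
    have hnhds : Metric.ball x₀ (r / 2) ∈ 𝓝 x₀ := Metric.ball_mem_nhds _ (by positivity)
    have htest : TestAt x₀ φ := by
      refine ⟨⟨M + ε, fun y => ?_⟩, by fun_prop, _, hnhds, hcd.contDiffOn.congr hφin⟩
      calc |φ y| ≤ |w y| + |ε * G (y - x₀)| := abs_sub _ _
        _ ≤ M + ε := by
          rw [abs_mul, abs_of_pos hε]
          exact add_le_add (hwM y) (mul_le_of_le_one_right hε.le (hG1 _))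
    have hmax : IsLocalMax φ x₀ := by
      filter_upwards [hnhds] with y hy
      rw [hφin y hy, hφ₀]
      linarith [mul_nonneg hε.le (one_sub_exp_neg_norm_sq_nonneg (y - x₀))]
    have hlt (y : Rd d) (hy : y ≠ x₀) : φ y < u y := by
      have h1 : 0 < G (y - x₀) := by
        have h2 : 0 < ‖y - x₀‖ := norm_pos_iff.2 (sub_ne_zero.2 hy)
        have h3 : Real.exp (-‖y - x₀‖ ^ 2) < Real.exp 0 :=
          Real.exp_lt_exp.2 (neg_lt_zero.2 (by positivity))
        rw [Real.exp_zero] at h3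
        exact sub_pos.2 h3
      have := mul_pos hε h1
      simp only [hφ]
      linarith [hwu y]
    have hineq := hsuper.2 x₀ hx₀ φ htest hφ₀ hlt
    have hop : psiOp S φ x₀ = (∫ z, F z * S.j ‖z‖) + ε * ∫ z, G z * S.j ‖z‖ := by
      rw [psiOp_of_isLocalMax S hmax, ← integral_const_mul, ← integral_add hFi (hGi.const_mul ε)]
      congr 1
      ext z
      rw [hφ₀]
      simp only [hφ, hF, add_sub_cancel_left]
      ring
    rw [hop] at hineq
    linarith
  have hlim : Tendsto (fun ε : ℝ => u x₀ * (c x₀ + I) + ε * ∫ z, G z * S.j ‖z‖) (𝓝[>] 0)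
      (𝓝 (u x₀ * (c x₀ + I) + 0 * ∫ z, G z * S.j ‖z‖)) :=
    Tendsto.mono_left (Continuous.tendsto (by fun_prop) _) nhdsWithin_le_nhds
  have h0 := ge_of_tendsto hlim (eventually_mem_nhdsWithin.mono hvisc)
  rw [zero_mul, add_zero] at h0
  by_contra! hpos
  linarith [mul_neg_of_neg_of_pos hneg hpos]

/-- A continuous function that is nonnegative on the boundary of a half-space and has nonnegative
lower limit at infinity attains its infimum over the half-space as soon as it is negative. -/
lemma exists_min_halfSpace {d : ℕ} {e : Rd d} {lam : ℝ} {u : Rd d → ℝ} (hu : Continuous u)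
    (hbdry : ∀ x, ⟪x, e⟫ = lam → 0 ≤ u x)
    (hinf : ∀ ε > (0 : ℝ), ∃ ρ : ℝ, ∀ x ∈ halfSpace e lam, ρ ≤ ‖x‖ → -ε ≤ u x)
    {x₁ : Rd d} (hx₁ : x₁ ∈ halfSpace e lam) (hneg : u x₁ < 0) :
    ∃ x₀ ∈ halfSpace e lam, u x₀ < 0 ∧ ∀ y ∈ halfSpace e lam, u x₀ ≤ u y := by
  obtain ⟨ρ, hρ⟩ := hinf (-u x₁ / 2) (by linarith)
  have hcomp : IsCompact (Metric.closedBall (0 : Rd d) (max ρ ‖x₁‖) ∩ {y | lam ≤ ⟪y, e⟫}) :=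
    (isCompact_closedBall _ _).inter_right (isClosed_le continuous_const (by fun_prop))
  have hx₁mem : x₁ ∈ Metric.closedBall (0 : Rd d) (max ρ ‖x₁‖) ∩ {y | lam ≤ ⟪y, e⟫} :=
    ⟨by simp, show lam ≤ ⟪x₁, e⟫ from le_of_lt hx₁⟩
  obtain ⟨x₀, hx₀, hmin⟩ := hcomp.exists_isMinOn ⟨x₁, hx₁mem⟩ hu.continuousOn
  have h01 : u x₀ ≤ u x₁ := hmin hx₁mem
  refine ⟨x₀, show lam < ⟪x₀, e⟫ from lt_of_le_of_ne hx₀.2 fun h => ?_, by linarith, fun y hy => ?_⟩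
  · linarith [hbdry x₀ h.symm]
  · rcases le_total ρ ‖y‖ with h | h
    · linarith [hρ y hy h]
    · exact hmin ⟨by simp [h], show lam ≤ ⟪y, e⟫ from le_of_lt hy⟩

/-- **Lemma 3.3** (maximum principle for antisymmetric supersolutions in
unbounded sets): given `c_∞, R > 0`, there is `δ > 0` such that any bounded
continuous antisymmetric viscosity supersolution of `Ψ(−Δ)u + c·u = 0` in
`Ω ⊂ H` — where `c⁻ ≤ c_∞`, `c ≥ 0` on `K ⊂ Ω` with `Ω∖K ⊂ B_R(0)` — that is
nonnegative on `(H∖Ω) ∪ ((Ω ∩ {dist(·,∂H) ≥ δ})∖K)` and has nonnegative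
liminf at infinity in `H`, is nonnegative on `H`. -/
theorem antisymmetric_maximum_principle_unbounded
    {d : ℕ} (hd : 2 ≤ d) (S : PsiSetting d) (hker : S.kernelCond)
    (e : Rd d) (he : ‖e‖ = 1) (lam : ℝ)
    (Ω : Set (Rd d)) (hΩ : Ω ⊆ halfSpace e lam) (hΩo : IsOpen Ω)
    (cinf R : ℝ) (hcinf : 0 < cinf) (hR : 0 < R) :
    ∃ δ > (0:ℝ), ∀ (c : Rd d → ℝ) (K : Set (Rd d)) (u : Rd d → ℝ),
      (∃ M, ∀ x ∈ Ω, |c x| ≤ M) → (∀ x ∈ Ω, max (-c x) 0 ≤ cinf) →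
      K ⊆ Ω → Ω \ K ⊆ Metric.ball (0 : Rd d) R → (∀ x ∈ K, 0 ≤ c x) →
      Continuous u → (∃ M, ∀ x, |u x| ≤ M) → AntiSym e lam u →
      IsSuperSol S Ω c (fun _ => 0) u →
      (∀ x ∈ (halfSpace e lam \ Ω) ∪
          ((Ω ∩ {x : Rd d | lam + δ ≤ ⟪x, e⟫}) \ K), 0 ≤ u x) →
      (∀ ε > (0:ℝ), ∃ ρ : ℝ, ∀ x ∈ halfSpace e lam, ρ ≤ ‖x‖ → -ε ≤ u x) →
      ∀ x ∈ halfSpace e lam, 0 ≤ u x := by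
  have hd0 : 0 < d := by omega
  obtain ⟨δ, hδ, hmass⟩ := S.exists_lt_setIntegral_j_inner_lt hd0 he cinf
  refine ⟨δ, hδ, fun c K u _ hcneg _ _ hcK hu ⟨M, hM⟩ hanti hsuper hnonneg hinf x₁ hx₁ => ?_⟩
  by_contra! hneg
  have hbdry (x : Rd d) (hx : ⟪x, e⟫ = lam) : 0 ≤ u x := by
    have := hanti x
    rw [reflAt_eq_self hx] at this
    linarith
  obtain ⟨x₀, hx₀H, hx₀neg, hmin⟩ := exists_min_halfSpace hu hbdry hinf hx₁ hneg
  have hx₀Ω : x₀ ∈ Ω := by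
    by_contra h
    exact hx₀neg.not_ge (hnonneg x₀ (Or.inl ⟨hx₀H, h⟩))
  have ha : 0 < ⟪x₀, e⟫ - lam := sub_pos.2 hx₀H
  have hle := hsuper.add_setIntegral_j_nonpos hd0 S he hu hM hanti hx₀Ω hx₀H hx₀neg hmin
  by_cases hK : x₀ ∈ K
  · linarith [hcK x₀ hK, S.setIntegral_j_inner_lt_pos hd0 he ha]
  · have hlt : ⟪x₀, e⟫ - lam ≤ δ := by
      by_contra! h
      refine hx₀neg.not_ge (hnonneg x₀ (Or.inr ⟨⟨hx₀Ω, ?_⟩, hK⟩))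
      simp only [Set.mem_ofPred_eq]
      linarith
    linarith [S.setIntegral_j_inner_lt_anti hd0 he ha hlt, hcneg x₀ hx₀Ω,
      le_max_left (-c x₀) 0]
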